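/- Let f: X → Y be a finite morphism of Noetherian projective schemes over an algebraically closed field k, both equipped with morphisms to a projective k-scheme Z such that the triangle commutes, and assume Y is integral. If for every closed point z ∈ Z the induced morphism on fibers f_z: X_z → Y_z is an isomorphism, then f is an isomorphism. -/

import Mathlib

open AlgebraicGeometry CategoryTheory CategoryTheory.Limits

theorem aux_nak {R S : Type*} [CommRing R] [CommRing S] [Algebra R S] [Module.Finite R S]
    (h : ∀ m : Ideal R, m.IsMaximal → ∀ s : S, ∃ r : R, s - algebraMap R S r ∈ m.map (algebraMap R S)) :
    Function.Surjective (algebraMap R S) := by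
  let N := LinearMap.range (Algebra.linearMap R S)
  have key : Module.annihilator R (S ⧸ N) = ⊤ := by
    by_contra hne
    obtain ⟨m, hm, hle⟩ := Ideal.exists_le_maximal _ hne
    have h1 : (⊤ : Submodule R (S ⧸ N)) ≤ m • ⊤ := by
      rintro x -
      obtain ⟨s, rfl⟩ := N.mkQ_surjective x
      obtain ⟨r, hr⟩ := h m hm s
      have h2 : N.mkQ s = N.mkQ (s - algebraMap R S r) := by
        rw [map_sub, eq_comm, sub_eq_self]
        simp only [Submodule.mkQ_apply, Submodule.Quotient.mk_eq_zero]
        exact ⟨r, rfl⟩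
      rw [h2]
      have h3 : s - algebraMap R S r ∈ (m • ⊤ : Submodule R S) := by
        rw [Ideal.smul_top_eq_map]; exact hr
      have h4 := Submodule.mem_map_of_mem (f := N.mkQ) h3
      rw [Submodule.map_smul''] at h4
      exact (Submodule.smul_mono le_rfl le_top) h4
    obtain ⟨r, hr, hr0⟩ := Submodule.exists_sub_one_mem_and_smul_eq_zero_of_fg_of_le_smul m _
      Module.Finite.fg_top h1
    have h5 : r ∈ m := hle (Module.mem_annihilator.mpr fun x => hr0 x trivial)
    exact hm.ne_top ((Ideal.eq_top_iff_one _).mpr (by simpa using m.sub_mem h5 hr))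
  intro s
  have h6 := Module.mem_annihilator.mp (key ▸ Submodule.mem_top : (1 : R) ∈ _) (N.mkQ s)
  rw [one_smul, Submodule.mkQ_apply, Submodule.Quotient.mk_eq_zero] at h6
  obtain ⟨r, hr⟩ := h6
  exact ⟨r, hr⟩

theorem aux_affine {R S : CommRingCat} (φ : R ⟶ S) (hφ : φ.hom.Finite)
    (h : ∀ m : Ideal R, m.IsMaximal →
      IsIso (pullback.snd (Spec.map φ) (Spec.map (CommRingCat.ofHom (Ideal.Quotient.mk m))))) :
    Function.Surjective φ.hom := by
  algebraize [φ.hom]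
  refine aux_nak fun m hm s => ?_
  have := h m hm
  let q := CommRingCat.ofHom (Ideal.Quotient.mk m)
  let I := m.map φ.hom
  let qS : S ⟶ CommRingCat.of (S ⧸ I) := CommRingCat.ofHom (Ideal.Quotient.mk I)
  let ψ : CommRingCat.of (R ⧸ m) ⟶ CommRingCat.of (S ⧸ I) :=
    CommRingCat.ofHom (Ideal.quotientMap I φ.hom Ideal.le_comap_map)
  have hc : φ ≫ qS = q ≫ ψ := by ext x; rfl
  let l := pullback.lift (f := Spec.map φ) (g := Spec.map q) (Spec.map qS) (Spec.map ψ)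
    (by rw [← Spec.map_comp, ← Spec.map_comp, hc])
  obtain ⟨σ, hσ⟩ := Spec.map_surjective (inv (pullback.snd (Spec.map φ) (Spec.map q)) ≫ pullback.fst _ _)
  have e : σ ≫ ψ = qS := by
    apply Spec.map_injective
    rw [Spec.map_comp, hσ]
    have e1 : l ≫ pullback.snd _ _ = Spec.map ψ := pullback.lift_snd _ _ _
    have e2 : l ≫ pullback.fst _ _ = Spec.map qS := pullback.lift_fst _ _ _
    rw [← e1, ← e2]; simp
  obtain ⟨r, hr⟩ := Ideal.Quotient.mk_surjective (σ.hom s)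
  refine ⟨r, Ideal.Quotient.eq.mp ?_⟩
  have e3 : ψ.hom (σ.hom s) = Ideal.Quotient.mk I s := congr($(e).hom s)
  rw [← hr] at e3
  exact e3.symm

theorem aux_pb {C : Type*} [Category C] [HasPullbacks C] {X Y Z W : C} (gX : X ⟶ Z) (gY : Y ⟶ Z)
    (w : W ⟶ Z) (f : X ⟶ Y) (hf : f ≫ gY = gX) (h1 : gX ≫ 𝟙 Z = f ≫ gY) (h2 : w ≫ 𝟙 Z = 𝟙 W ≫ w) :
    IsPullback (pullback.fst gX w) (pullback.map gX w gY w f (𝟙 _) (𝟙 _) h1 h2) f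
      (pullback.fst gY w) := by
  subst hf
  have e1 : pullback.map (f ≫ gY) w gY w f (𝟙 _) (𝟙 _) h1 h2 ≫ pullback.fst gY w =
      pullback.fst (f ≫ gY) w ≫ f := pullback.lift_fst _ _ _
  have e2 : pullback.map (f ≫ gY) w gY w f (𝟙 _) (𝟙 _) h1 h2 ≫ pullback.snd gY w =
      pullback.snd (f ≫ gY) w := (pullback.lift_snd _ _ _).trans (Category.comp_id _)
  have p := (IsPullback.of_hasPullback (f ≫ gY) w).flip
  rw [← e2] at p
  exact (IsPullback.of_right p e1 (IsPullback.of_hasPullback gY w).flip).flip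

/-- Lemma 4.1 of the paper. Let `X, Y, Z` be Noetherian projective
schemes over an algebraically closed field `k` (projectivity over `k` is encoded here by
properness of the structure morphisms to `Spec k`), with `Y` integral.  Let `f : X ⟶ Y`
be a finite morphism over `Z` (i.e. `f ≫ gY = gX`).  If for every closed point `z ∈ Z`
the induced morphism on scheme-theoretic fibers `f_z : X_z ⟶ Y_z` is an isomorphism,
then `f` is an isomorphism. -/
theorem stmt_3 (k : Type) [Field k] [IsAlgClosed k]
    (X Y Z : Scheme) [IsNoetherian X] [IsNoetherian Y] [IsNoetherian Z] [IsIntegral Y]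
    (sZ : Z ⟶ Spec (CommRingCat.of k)) (gX : X ⟶ Z) (gY : Y ⟶ Z)
    [IsProper (gX ≫ sZ)] [IsProper (gY ≫ sZ)] [IsProper sZ]
    (f : X ⟶ Y) (hf : f ≫ gY = gX) [IsFinite f]
    (hfibers : ∀ z : Z, IsClosed ({z} : Set Z) →
      IsIso (pullback.map gX (Z.fromSpecResidueField z) gY (Z.fromSpecResidueField z)
        f (𝟙 _) (𝟙 _) (by simp [hf]) (by simp))) :
    IsIso f := by
  have hJ : JacobsonSpace Y := LocallyOfFiniteType.jacobsonSpace (gY ≫ sZ)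
  have hgY : IsProper gY := IsProper.of_comp gY sZ
  have key : ∀ (K : Type) [Field K] (t : Spec (CommRingCat.of K) ⟶ Y) (x : Spec (CommRingCat.of K)),
      IsClosed ({t x} : Set Y) → ∀ {P : Scheme} (u : P ⟶ X) (v : P ⟶ Spec (CommRingCat.of K)),
      IsPullback u v f t → IsIso v := by
    intro K _ t x ht P u v p2
    obtain rfl : x = IsLocalRing.closedPoint K :=
      Subsingleton.elim (α := PrimeSpectrum K) _ _
    let z : Z := (t ≫ gY) (IsLocalRing.closedPoint K)
    have hzc : IsClosed ({z} : Set Z) := by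
      have := gY.isClosedMap _ ht
      rw [Set.image_singleton] at this
      exact this
    have hiso := hfibers z hzc
    let a := Spec.map (Z.descResidueField (Scheme.stalkClosedPointTo (t ≫ gY)))
    have ha : a ≫ Z.fromSpecResidueField z = t ≫ gY :=
      Scheme.descResidueField_stalkClosedPointTo_fromSpecResidueField K Z (t ≫ gY)
    have p1 : IsPullback (pullback.fst gX (Z.fromSpecResidueField z))
        (pullback.map gX (Z.fromSpecResidueField z) gY (Z.fromSpecResidueField z)
        f (𝟙 _) (𝟙 _) (by simp [hf]) (by simp)) f (pullback.fst gY (Z.fromSpecResidueField z)) :=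
      aux_pb _ _ _ _ hf _ _
    let b : Spec (CommRingCat.of K) ⟶ pullback gY (Z.fromSpecResidueField z) :=
      pullback.lift t a ha.symm
    have hb : b ≫ pullback.fst _ _ = t := pullback.lift_fst _ _ _
    rw [← hb] at p2
    have p3 := IsPullback.of_right' p2 p1
    exact (MorphismProperty.isomorphisms Scheme).of_isPullback p3 hiso
  have hcl : IsClosedImmersion f := by
    rw [IsZariskiLocalAtTarget.iff_of_openCover (P := @IsClosedImmersion) Y.affineCover]
    intro i
    obtain ⟨R, j, hj, hR⟩ : ∃ (R : CommRingCat.{0}) (j : Spec R ⟶ Y), IsOpenImmersion j ∧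
      (IsClosedImmersion (pullback.snd f j) →
        IsClosedImmersion (Y.affineCover.pullbackHom f i)) :=
        ⟨_, Y.affineCover.f i, Y.affineCover.map_prop i, id⟩
    apply hR
    have hfin : IsFinite (pullback.snd f j) := inferInstance
    have haff : IsAffine (pullback f j) := isAffine_of_isAffineHom (pullback.snd f j)
    let e := (pullback f j).isoSpec
    obtain ⟨φ, hφ⟩ := Spec.map_surjective (e.inv ≫ pullback.snd f j)
    have hφ' : pullback.snd f j = e.hom ≫ Spec.map φ := by rw [hφ]; simp
    rw [hφ', MorphismProperty.cancel_left_of_respectsIso @IsClosedImmersion]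
    have hfin2 : IsFinite (Spec.map φ) := by
      rw [hφ]
      have : IsFinite e.inv := inferInstance
      infer_instance
    refine IsClosedImmersion.spec_of_surjective φ (aux_affine φ ((IsFinite.SpecMap_iff _).mp hfin2) ?_)
    intro m hm
    let : Field (R ⧸ m) := Ideal.Quotient.field m
    let q := CommRingCat.ofHom (Ideal.Quotient.mk m)
    have pA : IsPullback (e.inv ≫ pullback.fst f j) (Spec.map φ) f j := by
      refine IsPullback.of_iso (IsPullback.of_hasPullback f j) e (Iso.refl _) (Iso.refl _) (Iso.refl _)
        ?_ ?_ ?_ ?_ <;> simp [hφ]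
    have pB := (IsPullback.of_hasPullback (Spec.map φ) (Spec.map q)).paste_horiz pA
    let x : Spec (CommRingCat.of (R ⧸ m)) := IsLocalRing.closedPoint (R ⧸ m)
    refine key (R ⧸ m) (Spec.map q ≫ j) x ?_ _ _ pB
    have hx : Spec.map q x ∈ closedPoints (Spec R) := by
      have h1 : IsClosedImmersion (Spec.map q) :=
        IsClosedImmersion.spec_of_surjective q Ideal.Quotient.mk_surjective
      have h2 := (Spec.map q).isClosedMap {x} (by
        convert isClosed_univ
        ext w
        simp only [Set.mem_singleton_iff, Set.mem_univ, iff_true]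
        exact Subsingleton.elim (α := PrimeSpectrum (R ⧸ m)) _ _)
      rw [Set.image_singleton] at h2
      exact h2
    rw [← j.isOpenEmbedding.preimage_closedPoints] at hx
    exact hx
  have hsurj : Surjective f := by
    have hcr : IsClosed (Set.range f) := f.isClosedMap.isClosed_range
    refine ⟨Set.range_eq_univ.mp ?_⟩
    rw [← hcr.closure_eq, ← Set.univ_subset_iff, ← closure_closedPoints (X := Y)]
    refine closure_mono fun y hy => ?_
    let x : Spec (Y.residueField y) := IsLocalRing.closedPoint (Y.residueField y)
    have hxy : Y.fromSpecResidueField y x = y := Y.fromSpecResidueField_apply y x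
    have := key (Y.residueField y) (Y.fromSpecResidueField y) x (by rw [hxy]; exact hy) _ _
      (IsPullback.of_hasPullback _ _)
    refine ⟨(inv (pullback.snd f (Y.fromSpecResidueField y)) ≫ pullback.fst _ _) x, ?_⟩
    rw [← Scheme.Hom.comp_apply, Category.assoc, pullback.condition, IsIso.inv_hom_id_assoc]
    exact hxy
  exact isIso_of_isClosedImmersion_of_surjective f
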